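/- Let a > 0, let p : ℝ³ → ℂ be integrable and vanish outside the closed ball of radius a, and define P(z) := ∫_{ℝ³} p(x) e^{i z·x} dx for z ∈ ℂ³, where z·x := z₁x₁ + z₂x₂ + z₃x₃. Let α₀ ∈ S² be fixed and let η₀ > 0. If P((k+iη)(α₀+β)) = 0 for all k > 0, all η > η₀, and all β ∈ S², then p = 0 almost everywhere. -/

import Mathlib

open MeasureTheory Complex

noncomputable section

abbrev E3 : Type := EuclideanSpace ℝ (Fin 3)

/-- The unit sphere `S²` in `ℝ³`. -/
def sphere2 : Set E3 := {β : E3 | ‖β‖ = 1}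

/-- The bilinear pairing `z·x = z₁x₁ + z₂x₂ + z₃x₃` of a complex vector with a real vector. -/
def cdot (z : Fin 3 → ℂ) (x : E3) : ℂ := ∑ j : Fin 3, z j * (x j : ℂ)

/-- The entire extension `P(z) = ∫ p(x) e^{i z·x} dx` of the Fourier transform of `p` to `ℂ³`. -/
def FT3 (p : E3 → ℂ) (z : Fin 3 → ℂ) : ℂ :=
  ∫ x : E3, p x * Complex.exp (Complex.I * cdot z x)

end

open scoped FourierTransform SchwartzMap ContDiff RealInnerProductSpace

/-- An integrable function with vanishing Fourier transform vanishes almost everywhere. -/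
theorem ae_eq_zero_of_fourier_eq_zero {V : Type*} [NormedAddCommGroup V] [InnerProductSpace ℝ V]
    [FiniteDimensional ℝ V] [MeasurableSpace V] [BorelSpace V] {f : V → ℂ} (hf : Integrable f)
    (h : ∀ w, 𝓕 f w = 0) : f =ᵐ[volume] 0 := by
  refine ae_eq_zero_of_integral_contDiff_smul_eq_zero hf.locallyIntegrable fun g hg hgc => ?_
  have hgc' : HasCompactSupport (fun x => (g x : ℂ)) := hgc.comp_left Complex.ofReal_zero
  have hg' : ContDiff ℝ ∞ (fun x => (g x : ℂ)) := Complex.ofRealCLM.contDiff.comp hg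
  let G : 𝓢(V, ℂ) := hgc'.toSchwartzMap hg'
  have hflip := VectorFourier.integral_fourierIntegral_smul_eq_flip (μ := volume) (ν := volume)
    (L := innerₗ V) Real.continuous_fourierChar continuous_inner hf (𝓕⁻ G).integrable
  have hG : 𝓕 ((𝓕⁻ G : 𝓢(V, ℂ)) : V → ℂ) = G := by
    rw [← SchwartzMap.fourier_coe, FourierTransform.fourier_fourierInv_eq]
  rw [flip_innerₗ] at hflip
  change ∫ ξ, 𝓕 f ξ • _ = ∫ x, f x • 𝓕 ((𝓕⁻ G : 𝓢(V, ℂ)) : V → ℂ) x at hflip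
  rw [hG] at hflip
  simp only [h, zero_smul, integral_zero] at hflip
  rw [hflip]
  refine integral_congr_ae (.of_forall fun x => ?_)
  change g x • f x = f x • (g x : ℂ)
  rw [Complex.real_smul, smul_eq_mul, mul_comm]

theorem cdot_smul_ofReal (w : ℂ) (v x : E3) :
    cdot (fun j => w * ((v j : ℝ) : ℂ)) x = w * (⟪v, x⟫ : ℝ) := by
  simp only [cdot, PiLp.inner_apply, Finset.mul_sum, Complex.ofReal_sum]
  refine Finset.sum_congr rfl fun j _ => ?_
  simp only [RCLike.inner_apply, conj_trivial, Complex.ofReal_mul]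
  ring

theorem fourier_eq_FT3 (p : E3 → ℂ) (v : E3) :
    𝓕 p v = FT3 p (fun j => ((-2 * Real.pi : ℝ) : ℂ) * ((v j : ℝ) : ℂ)) := by
  rw [Real.fourier_eq', FT3]
  refine integral_congr_ae (.of_forall fun x => ?_)
  simp only [cdot_smul_ofReal, smul_eq_mul, real_inner_comm v x]
  rw [mul_comm]
  congr 2
  push_cast
  ring

/-- The entire extension of the Fourier transform of a compactly supported integrable function
is entire along every complex line through the origin with real direction. -/
theorem differentiable_FT3_smul {a : ℝ} {p : E3 → ℂ} (hp : Integrable p)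
    (hsupp : ∀ x : E3, a < ‖x‖ → p x = 0) (v : E3) :
    Differentiable ℂ fun w : ℂ => FT3 p (fun j => w * ((v j : ℝ) : ℂ)) := by
  intro w₀
  simp only [FT3, cdot_smul_ofReal]
  have hmeas (w : ℂ) : AEStronglyMeasurable
      (fun x : E3 => p x * Complex.exp (Complex.I * (w * (⟪v, x⟫ : ℝ)))) volume :=
    hp.aestronglyMeasurable.mul (by fun_prop)
  set M : ℝ := ‖v‖ * a
  have hinner {x : E3} (hx : ‖x‖ ≤ a) : ‖((⟪v, x⟫ : ℝ) : ℂ)‖ ≤ M := by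
    rw [Complex.norm_real]
    exact (norm_inner_le_norm v x).trans (mul_le_mul_of_nonneg_left hx (norm_nonneg v))
  have hexp {w : ℂ} {R : ℝ} (hw : ‖w‖ ≤ R) {x : E3} (hx : ‖x‖ ≤ a) :
      ‖Complex.exp (Complex.I * (w * (⟪v, x⟫ : ℝ)))‖ ≤ Real.exp (R * M) := by
    refine (Complex.norm_exp_le_exp_norm _).trans (Real.exp_le_exp.2 ?_)
    rw [norm_mul, norm_mul, Complex.norm_I, one_mul]
    exact mul_le_mul hw (hinner hx) (norm_nonneg _) ((norm_nonneg _).trans hw)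
  have hint : Integrable
      (fun x : E3 => p x * Complex.exp (Complex.I * (w₀ * (⟪v, x⟫ : ℝ)))) volume := by
    refine (hp.norm.mul_const (Real.exp (‖w₀‖ * M))).mono' (hmeas w₀) (.of_forall fun x => ?_)
    rcases lt_or_ge a ‖x‖ with hx | hx
    · simp [hsupp x hx]
    · rw [norm_mul]
      gcongr
      exact hexp le_rfl hx
  refine (hasDerivAt_integral_of_dominated_loc_of_deriv_le
    (F' := fun w x => p x * (Complex.exp (Complex.I * (w * (⟪v, x⟫ : ℝ))) *
      (Complex.I * (⟪v, x⟫ : ℝ))))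
    (bound := fun x => ‖p x‖ * (Real.exp ((‖w₀‖ + 1) * M) * M))
    (Metric.ball_mem_nhds w₀ one_pos) (.of_forall hmeas) hint
    (hp.aestronglyMeasurable.mul (by fun_prop)) (.of_forall fun x w hw => ?_)
    (hp.norm.mul_const _) (.of_forall fun x w _ => ?_)).2.differentiableAt
  · rcases lt_or_ge a ‖x‖ with hx | hx
    · simp [hsupp x hx]
    · have hw' : ‖w‖ ≤ ‖w₀‖ + 1 := by
        have := norm_le_norm_add_norm_sub' w w₀
        rw [mem_ball_iff_norm] at hw
        linarith
      rw [norm_mul, norm_mul, norm_mul, Complex.norm_I, one_mul]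
      gcongr
      · exact hexp hw' hx
      · exact hinner hx
  · have := (((hasDerivAt_id w).mul_const ((⟪v, x⟫ : ℝ) : ℂ)).const_mul Complex.I).cexp
    simpa using this.const_mul (p x)

/-- An entire function vanishing on a quadrant `{k + iη : k > 0, η > η₀}` vanishes identically. -/
theorem eq_zero_of_forall_quadrant {f : ℂ → ℂ} (hf : Differentiable ℂ f) {η₀ : ℝ}
    (h : ∀ k > (0 : ℝ), ∀ η > η₀, f ((k : ℂ) + (η : ℂ) * Complex.I) = 0) (w : ℂ) : f w = 0 := by
  have hopen : IsOpen {z : ℂ | 0 < z.re ∧ η₀ < z.im} :=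
    (isOpen_lt continuous_const Complex.continuous_re).inter
      (isOpen_lt continuous_const Complex.continuous_im)
  have hmem : (⟨1, η₀ + 1⟩ : ℂ) ∈ {z : ℂ | 0 < z.re ∧ η₀ < z.im} := by simp
  have han : AnalyticOnNhd ℂ f Set.univ := hf.differentiableOn.analyticOnNhd isOpen_univ
  refine han.eqOn_zero_of_preconnected_of_eventuallyEq_zero isPreconnected_univ
    (Set.mem_univ (⟨1, η₀ + 1⟩ : ℂ)) ?_ (Set.mem_univ w)
  filter_upwards [hopen.mem_nhds hmem] with z hz
  simpa [Complex.re_add_im] using h z.re hz.1 z.im hz.2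

/-- A vector not orthogonal to the unit vector `α` is a multiple of `α + β` for some unit `β`. -/
theorem exists_eq_smul_add_of_inner_ne_zero {V : Type*} [NormedAddCommGroup V]
    [InnerProductSpace ℝ V] {α v : V} (hα : ‖α‖ = 1) (hv : ⟪v, α⟫ ≠ 0) :
    ∃ r : ℝ, ∃ β : V, ‖β‖ = 1 ∧ v = r • (α + β) := by
  have hv0 : ‖v‖ ≠ 0 := by
    intro hv'
    rw [norm_eq_zero] at hv'
    simp [hv'] at hv
  set s : ℝ := 2 * ⟪v, α⟫ / ‖v‖ ^ 2 with hs
  have hs0 : s ≠ 0 := by positivity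
  refine ⟨s⁻¹, s • v - α, ?_, ?_⟩
  · have : ‖s • v - α‖ ^ 2 = 1 := by
      rw [norm_sub_sq_real, norm_smul, mul_pow, Real.norm_eq_abs, sq_abs, real_inner_smul_left, hα,
        hs]
      field_simp
      ring
    exact (pow_eq_one_iff_of_nonneg (norm_nonneg _) two_ne_zero).1 this
  · rw [add_sub_cancel, inv_smul_smul₀ hs0]

/-- If the entire extension of the Fourier transform of a compactly supported integrable
function `p` vanishes at all points `(k+iη)(α₀+β)`, `k > 0`, `η > η₀`, `β ∈ S²`,
then `p = 0` a.e. -/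
theorem vanishing_on_complex_fixed_direction_set
    (a : ℝ) (ha : 0 < a) (p : E3 → ℂ) (hp : Integrable p)
    (hsupp : ∀ x : E3, a < ‖x‖ → p x = 0)
    (α₀ : E3) (hα₀ : α₀ ∈ sphere2)
    (η₀ : ℝ) (hη₀ : 0 < η₀)
    (h : ∀ k > (0 : ℝ), ∀ η > η₀, ∀ β ∈ sphere2,
      FT3 p (fun j => ((k : ℂ) + (η : ℂ) * Complex.I) * (((α₀ + β) j : ℝ) : ℂ)) = 0) :
    p =ᵐ[volume] 0 := by
  have hα : ‖α₀‖ = 1 := hα₀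
  refine ae_eq_zero_of_fourier_eq_zero hp ?_
  have hgen (v : E3) (hv : ⟪v, α₀⟫ ≠ 0) : 𝓕 p v = 0 := by
    obtain ⟨r, β, hβ, rfl⟩ := exists_eq_smul_add_of_inner_ne_zero hα hv
    have := eq_zero_of_forall_quadrant (differentiable_FT3_smul hp hsupp (α₀ + β))
      (fun k hk η hη => h k hk η hη β hβ) (((-2 * Real.pi * r : ℝ) : ℂ))
    rw [fourier_eq_FT3, ← this]
    congr 1
    ext j
    simp only [PiLp.smul_apply, smul_eq_mul]
    push_cast
    ring
  intro v
  by_cases hv : ⟪v, α₀⟫ = 0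
  · have hcont : Continuous (𝓕 p) := VectorFourier.fourierIntegral_continuous
      Real.continuous_fourierChar (L := innerₗ E3) continuous_inner hp
    have hline : (fun t : ℝ => 𝓕 p (v + t • α₀)) = fun _ => 0 := by
      refine Continuous.ext_on (dense_compl_singleton (0 : ℝ)) (by fun_prop) continuous_const ?_
      intro t ht
      refine hgen _ ?_
      rw [inner_add_left, hv, real_inner_smul_left, real_inner_self_eq_norm_sq, hα]
      simpa using ht
    simpa using congrFun hline 0
  · exact hgen v hv
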